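/- arXiv:1005.2316 — 8 statements merged into one kernel-verified Lean document; each statement's English description precedes it below -/
import Mathlib

section
/- Let q be a prime power, r ≥ 2, and G = SL_{r+1}(F_q). Suppose t1 ∈ G has irreducible characteristic polynomial over F_q and the characteristic polynomial of t2 ∈ G has a monic irreducible factor of degree r over F_q. Let T1 = Z_G(t1) and T2 = Z_G(t2) be their centralizers in G. Then for every g ∈ G, every element of T1 ∩ g⁻¹ T2 g is a scalar matrix; that is, T1 ∩ g⁻¹ T2 g = Z(G). -/
open Polynomial in
/-- An endomorphism commuting with one whose characteristic polynomial is irreducible is a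
homothety as soon as it has an eigenvector. -/
theorem eq_smul_of_commute_of_irreducible_charpoly {K V : Type*} [Field K] [AddCommGroup V]
    [Module K V] [FiniteDimensional K V] {f h : Module.End K V} (hf : Irreducible f.charpoly)
    (hc : Commute h f) {v : V} (hv : v ≠ 0) {b : K} (hb : h v = b • v) (w : V) :
    h w = b • w := by
  have eval_ne_zero (p : K[X]) (hp : p ≠ 0) (hdeg : p.degree < Module.finrank K V) :
      aeval f p v ≠ 0 := by
    intro hpv
    have hndvd : ¬ f.charpoly ∣ p := fun hdvd ↦ by
      have := degree_le_of_dvd hdvd hp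
      rw [degree_eq_natDegree f.charpoly_monic.ne_zero, f.charpoly_natDegree] at this
      exact absurd hdeg this.not_gt
    obtain ⟨c, d, hcd⟩ := (hf.coprime_iff_not_dvd).2 hndvd
    have := congrArg (fun P ↦ aeval f P v) hcd
    simp [LinearMap.aeval_self_charpoly, hpv] at this
    exact hv this.symm
  let φ : degreeLT K (Module.finrank K V) →ₗ[K] V :=
    (LinearMap.applyₗ v ∘ₗ (aeval f).toLinearMap) ∘ₗ Submodule.subtype _
  have hφ (p) : φ p = aeval f (p : K[X]) v := rfl
  have e := degreeLTEquiv K (Module.finrank K V)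
  have : FiniteDimensional K (degreeLT K (Module.finrank K V)) := e.symm.finiteDimensional
  have hφ_inj : Function.Injective φ := by
    refine (injective_iff_map_eq_zero φ).2 fun p hp ↦ ?_
    by_contra hne
    exact eval_ne_zero p (by simpa using hne) (mem_degreeLT.1 p.2) hp
  have hφ_surj : Function.Surjective φ :=
    (LinearMap.injective_iff_surjective_of_finrank_eq_finrank
      (by rw [e.finrank_eq, Module.finrank_fin_fun])).1 hφ_inj
  obtain ⟨p, rfl⟩ := hφ_surj w
  have hcp : Commute h (aeval f (p : K[X])) := by
    induction (p : K[X]) using Polynomial.induction_on' with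
    | add p q hp hq => simpa using hp.add_right hq
    | monomial n c =>
      rw [aeval_monomial]
      exact (Algebra.commute_algebraMap_right c h).mul_right (hc.pow_right n)
  rw [hφ, ← Module.End.mul_apply, hcp.eq, Module.End.mul_apply, hb, map_smul]

/-- An eigenvector for a simple root of the characteristic polynomial of `f` is an eigenvector of
every endomorphism commuting with `f`. -/
theorem exists_apply_eq_smul_of_commute_of_rootMultiplicity_le_one {K V : Type*} [Field K]
    [AddCommGroup V] [Module K V] [FiniteDimensional K V] {f h : Module.End K V} {a : K}
    (ha : f.charpoly.rootMultiplicity a ≤ 1) (hc : Commute h f) {v : V}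
    (hv : f.HasEigenvector a v) : ∃ b : K, h v = b • v := by
  have hle : Module.finrank K (f.eigenspace a) ≤ 1 := (f.finrank_eigenspace_le a).trans ha
  have hmem : h v ∈ f.eigenspace a := by
    rw [Module.End.mem_eigenspace_iff, ← Module.End.mul_apply, ← hc.eq, Module.End.mul_apply,
      hv.apply_eq_smul, map_smul]
  have hne : (⟨v, hv.1⟩ : f.eigenspace a) ≠ 0 := by simpa using hv.2
  have hone : Module.finrank K (f.eigenspace a) = 1 :=
    le_antisymm hle (Module.finrank_pos_iff_exists_ne_zero.2 ⟨_, hne⟩)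
  obtain ⟨b, hb⟩ := (finrank_eq_one_iff_of_nonzero' _ hne).1 hone ⟨h v, hmem⟩
  exact ⟨b, (congrArg Subtype.val hb).symm⟩

open Polynomial in
/-- A monic polynomial of degree `r + 1` with an irreducible factor of degree `r ≥ 2` has a simple
root. -/
theorem exists_rootMultiplicity_eq_one_of_irreducible_dvd {K : Type*} [Field K] {P p : K[X]} {r : ℕ}
    (hr : 2 ≤ r) (hP : P.Monic) (hPdeg : P.natDegree = r + 1) (hp : p.Monic) (hirr : Irreducible p)
    (hpdeg : p.natDegree = r) (hdvd : p ∣ P) : ∃ a : K, P.rootMultiplicity a = 1 := by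
  obtain ⟨q, rfl⟩ := hdvd
  have hq : q.Monic := hp.of_mul_monic_left hP
  have hqdeg : q.natDegree = 1 := by
    rw [hp.natDegree_mul hq] at hPdeg
    omega
  have hq_eq := hq.eq_X_add_C hqdeg
  refine ⟨-q.coeff 0, ?_⟩
  have hp_root : ¬ p.IsRoot (-q.coeff 0) := hirr.not_isRoot_of_natDegree_ne_one (by omega)
  rw [rootMultiplicity_mul hP.ne_zero, rootMultiplicity_eq_zero hp_root, zero_add]
  have : q = X - C (-q.coeff 0) := by rw [C_neg, sub_neg_eq_add, ← hq_eq]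
  exact (congrArg (rootMultiplicity (-q.coeff 0)) this).trans rootMultiplicity_X_sub_C_self


/-- Let `t₁ ∈ SL_{r+1}(F_q)` have irreducible characteristic polynomial and let the
characteristic polynomial of `t₂` have a monic irreducible factor of degree `r` (with
`r ≥ 2`).  If `T₁, T₂` are their centralizers, then for every `g`,
`T₁ ∩ g⁻¹ T₂ g` is the center of `SL_{r+1}(F_q)`. -/
theorem centralizer_inter_conj_centralizer_eq_center
    (F : Type*) [Field F] [Fintype F] (r : ℕ) (hr : 2 ≤ r)
    (t₁ t₂ : Matrix.SpecialLinearGroup (Fin (r + 1)) F)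
    (ht₁ : Irreducible (Matrix.charpoly (t₁ : Matrix (Fin (r + 1)) (Fin (r + 1)) F)))
    (ht₂ : ∃ p : Polynomial F, p.Monic ∧ Irreducible p ∧ p.natDegree = r ∧
      p ∣ Matrix.charpoly (t₂ : Matrix (Fin (r + 1)) (Fin (r + 1)) F))
    (g : Matrix.SpecialLinearGroup (Fin (r + 1)) F) :
    Subgroup.centralizer ({t₁} : Set (Matrix.SpecialLinearGroup (Fin (r + 1)) F)) ⊓
      Subgroup.map (MulAut.conj g⁻¹).toMonoidHom
        (Subgroup.centralizer ({t₂} : Set (Matrix.SpecialLinearGroup (Fin (r + 1)) F))) =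
      Subgroup.center (Matrix.SpecialLinearGroup (Fin (r + 1)) F) := by
  open Matrix Matrix.SpecialLinearGroup in
  refine le_antisymm ?_ (le_inf (Subgroup.center_le_centralizer _) fun x hx ↦ ?_)
  · rintro x ⟨hx₁, y, hy, rfl⟩
    have hy := Subgroup.mem_centralizer_singleton_iff.1 hy
    have hx₁ := Subgroup.mem_centralizer_singleton_iff.1 hx₁
    obtain ⟨p, hp, hirr, hpdeg, hdvd⟩ := ht₂
    obtain ⟨a, ha⟩ := exists_rootMultiplicity_eq_one_of_irreducible_dvd hr
      (charpoly_monic _) (by simp) hp hirr hpdeg hdvd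
    let ρ : SpecialLinearGroup (Fin (r + 1)) F →* Module.End F (Fin (r + 1) → F) :=
      (toLinAlgEquiv' : _ ≃ₐ[F] _).toMulEquiv.toMonoidHom.comp coeMonoidHom
    have hρ (s) : ρ s = toLin' (s : Matrix (Fin (r + 1)) (Fin (r + 1)) F) := rfl
    rw [← charpoly_toLin', ← hρ] at ha ht₁
    have hroot : (ρ t₂).charpoly.IsRoot a :=
      (Polynomial.rootMultiplicity_pos (LinearMap.charpoly_monic _).ne_zero).1 (by omega)
    obtain ⟨v, hv⟩ :=
      ((Module.End.hasEigenvalue_iff_isRoot_charpoly _ _).2 hroot).exists_hasEigenvector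
    obtain ⟨b, hb⟩ := exists_apply_eq_smul_of_commute_of_rootMultiplicity_le_one ha.le
      (Commute.map hy ρ) hv
    set x := (MulAut.conj g⁻¹).toMonoidHom y with hx
    have hgx : x * g⁻¹ = g⁻¹ * y := by simp [hx, mul_assoc]
    have hgv : ρ g⁻¹ v ≠ 0 := fun h0 ↦ hv.2 <| by
      rw [← Module.End.one_apply (R := F) v, ← map_one ρ, ← mul_inv_cancel g, map_mul,
        Module.End.mul_apply, h0, map_zero]
    have hxgv : ρ x (ρ g⁻¹ v) = b • ρ g⁻¹ v := by
      rw [← Module.End.mul_apply, ← map_mul, hgx, map_mul, Module.End.mul_apply, hb, map_smul]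
    have hxb := eq_smul_of_commute_of_irreducible_charpoly ht₁ (Commute.map hx₁ ρ) hgv hxgv
    have hxs : (x : Matrix (Fin (r + 1)) (Fin (r + 1)) F) = scalar (Fin (r + 1)) b := by
      refine toLin'.injective (LinearMap.ext fun w ↦ ?_)
      rw [← hρ, hxb, Matrix.toLin'_apply, scalar_apply, ← smul_one_eq_diagonal, smul_mulVec, one_mulVec]
    refine mem_center_iff.2 ⟨b, ?_, hxs.symm⟩
    have hdet := x.det_coe
    rwa [hxs, scalar_apply, det_diagonal, Finset.prod_const, Finset.card_univ] at hdet
  · refine ⟨x, Subgroup.center_le_centralizer _ hx, ?_⟩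
    simp [Subgroup.mem_center_iff.1 hx g⁻¹]
end

section
/- Let F ⊆ K be an extension of finite fields with |F| = q and [K : F] = n ≥ 2. Then the number of elements α ∈ K such that F(α) ≠ K is strictly less than 2·q^{⌊n/2⌋}. -/
open Polynomial in
theorem card_filter_pow_eq_self_le {K : Type*} [Field K] [Fintype K] [DecidableEq K]
    {m : ℕ} (hm : 1 < m) : (Finset.univ.filter fun x : K => x ^ m = x).card ≤ m := by
  have h0 : (X ^ m - X : K[X]) ≠ 0 := FiniteField.X_pow_card_sub_X_ne_zero K hm
  calc (Finset.univ.filter fun x : K => x ^ m = x).card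
      ≤ (X ^ m - X : K[X]).natDegree := by
        refine card_le_degree_of_subset_roots fun x hx => ?_
        have hx' : x ^ m = x := by simpa using hx
        simp [mem_roots h0, hx']
    _ = m := FiniteField.X_pow_card_sub_X_natDegree_eq K hm

theorem sum_Icc_pow_add_two_le {q : ℕ} (hq : 2 ≤ q) (m : ℕ) :
    ∑ d ∈ Finset.Icc 1 m, q ^ d + 2 ≤ 2 * q ^ m := by
  induction m with
  | zero => simp
  | succ m ih =>
    rw [Finset.sum_Icc_succ_top (by omega)]
    have : 2 * q ^ m ≤ q ^ (m + 1) := by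
      rw [pow_succ']
      exact Nat.mul_le_mul_right _ hq
    omega

theorem IntermediateField.pow_card_pow_finrank {F K : Type*} [Field F] [Field K] [Algebra F K]
    [Fintype F] [Finite K] (E : IntermediateField F K) {x : K} (hx : x ∈ E) :
    x ^ Fintype.card F ^ Module.finrank F E = x := by
  have := Fintype.ofFinite E
  have h := FiniteField.pow_card (⟨x, hx⟩ : E)
  rw [Module.card_eq_pow_finrank (K := F) (V := E)] at h
  simpa using congrArg Subtype.val h

theorem IntermediateField.finrank_le_half_of_ne_top {F K : Type*} [Field F] [Field K]
    [Algebra F K] [FiniteDimensional F K] {E : IntermediateField F K} (hE : E ≠ ⊤) :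
    Module.finrank F E ≤ Module.finrank F K / 2 := by
  have h1 : Module.finrank E K ≠ 1 := fun h =>
    hE (IntermediateField.finrank_eq_one_iff_eq_top.mp h)
  have h0 : 0 < Module.finrank E K := Module.finrank_pos
  rw [Nat.le_div_iff_mul_le two_pos, ← Module.finrank_mul_finrank F E K]
  exact Nat.mul_le_mul_left _ (by omega)

/-- If `F ⊆ K` are finite fields with `|F| = q` and `[K : F] = n ≥ 2`, then the number
of `α ∈ K` not generating `K` over `F` is less than `2 q^⌊n/2⌋`. -/
theorem card_non_generators_lt
    (F K : Type*) [Field F] [Field K] [Algebra F K] [Fintype F] [Fintype K]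
    (q n : ℕ) (hq : Fintype.card F = q) (hn : Module.finrank F K = n) (h2 : 2 ≤ n) :
    Nat.card {α : K // IntermediateField.adjoin F ({α} : Set K) ≠ ⊤} < 2 * q ^ (n / 2) := by
  classical
  have hq2 : 2 ≤ q := hq ▸ Fintype.one_lt_card
  rw [Nat.card_eq_fintype_card, Fintype.card_subtype]
  have hsub : (Finset.univ.filter fun α : K => IntermediateField.adjoin F ({α} : Set K) ≠ ⊤) ⊆
      (Finset.Icc 1 (n / 2)).biUnion
        fun d => Finset.univ.filter fun x : K => x ^ q ^ d = x := by
    intro α hα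
    have hα' : IntermediateField.adjoin F ({α} : Set K) ≠ ⊤ := (Finset.mem_filter.mp hα).2
    refine Finset.mem_biUnion.mpr
      ⟨Module.finrank F (IntermediateField.adjoin F ({α} : Set K)), ?_, ?_⟩
    · exact Finset.mem_Icc.mpr
        ⟨Module.finrank_pos, hn ▸ IntermediateField.finrank_le_half_of_ne_top hα'⟩
    · rw [Finset.mem_filter, ← hq]
      exact ⟨Finset.mem_univ _, IntermediateField.pow_card_pow_finrank _
        (IntermediateField.mem_adjoin_simple_self F α)⟩
  have hle := (Finset.card_le_card hsub).trans <| Finset.card_biUnion_le.trans <|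
    Finset.sum_le_sum fun d hd => card_filter_pow_eq_self_le (K := K)
      (Nat.one_lt_pow (n := d) (by have := (Finset.mem_Icc.mp hd).1; omega) hq2)
  have := sum_Icc_pow_add_two_le hq2 (n / 2)
  omega
end

section
/- Let F ⊆ K be an extension of finite fields with |F| = q and [K : F] = r + 1 where r ≥ 2, and suppose q^{r−1} ≥ 16. Let N : K → F denote the field norm. Then the number of elements α ∈ K with N(α) = 1 and F(α) = K is strictly greater than (1/2)·(q^{r+1} − 1)/(q − 1). -/
/-- The number of norm-one elements in an extension of finite fields. -/
theorem card_norm_eq_one_mul (F K : Type*) [Field F] [Field K] [Algebra F K] [Finite F] [Finite K] :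
    Nat.card {α : K // Algebra.norm F α = 1} * (Nat.card F - 1) = Nat.card K - 1 := by
  let f : Kˣ →* Fˣ := Units.map (Algebra.norm F (S := K))
  have e : f.ker ≃ {α : K // Algebra.norm F α = 1} :=
    { toFun u := ⟨u.1, congrArg Units.val (MonoidHom.mem_ker.mp u.2)⟩
      invFun α := ⟨Units.mk0 α.1 (by
        intro h
        have h1 := α.2
        rw [h, Algebra.norm_zero] at h1
        exact zero_ne_one h1), MonoidHom.mem_ker.mpr (Units.ext α.2)⟩
      left_inv u := by ext; rfl
      right_inv α := rfl }
  have hrange : f.range = ⊤ :=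
    MonoidHom.range_eq_top.mpr (FiniteField.unitsMap_norm_surjective F K)
  have h := f.ker.card_mul_index
  rwa [Subgroup.index_ker, hrange, Subgroup.card_top, Nat.card_congr e, Nat.card_units,
    Nat.card_units] at h

/-- A nonzero element of an extension of finite fields that does not generate the extension is a
root of unity of order dividing `|F| ^ d - 1` for some `d` at most half of the degree. -/
theorem exists_pow_eq_one_of_adjoin_ne_top {F K : Type*} [Field F] [Field K] [Algebra F K]
    [Finite F] [Finite K] {α : K} (h0 : α ≠ 0) (h : IntermediateField.adjoin F {α} ≠ ⊤) :
    ∃ d ∈ Finset.Icc 1 (Module.finrank F K / 2), α ^ (Nat.card F ^ d - 1) = 1 := by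
  set L := IntermediateField.adjoin F ({α} : Set K) with hL
  have hmul := Module.finrank_mul_finrank F L K
  have hne : Module.finrank L K ≠ 1 := fun h1 =>
    h (IntermediateField.finrank_eq_one_iff_eq_top.mp h1)
  have hpos : 0 < Module.finrank L K := Module.finrank_pos
  refine ⟨Module.finrank F L, Finset.mem_Icc.mpr ⟨Module.finrank_pos, ?_⟩, ?_⟩
  · rw [Nat.le_div_iff_mul_le two_pos, ← hmul]
    exact Nat.mul_le_mul_left _ (by omega)
  · have := Fintype.ofFinite L
    let a : L := ⟨α, IntermediateField.mem_adjoin_simple_self F α⟩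
    have ha : a ≠ 0 := fun h1 => h0 (congrArg Subtype.val h1)
    have h1 := FiniteField.pow_card_sub_one_eq_one a ha
    rw [← Nat.card_eq_fintype_card, Module.natCard_eq_pow_finrank (K := F)] at h1
    exact congrArg Subtype.val h1

/-- A bound for the number of nonzero elements of an extension of finite fields that
lie in a proper subextension, by summing over the possible degrees of the subextension. -/
theorem card_adjoin_ne_top_le (F K : Type*) [Field F] [Field K] [Algebra F K]
    [Finite F] [Finite K] :
    Nat.card {α : K // α ≠ 0 ∧ IntermediateField.adjoin F ({α} : Set K) ≠ ⊤} ≤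
      ∑ d ∈ Finset.Icc 1 (Module.finrank F K / 2), (Nat.card F ^ d - 1) := by
  classical
  let s : Finset K := (Finset.Icc 1 (Module.finrank F K / 2)).biUnion
    fun d => Polynomial.nthRootsFinset (Nat.card F ^ d - 1) (1 : K)
  have hsub : {α : K | α ≠ 0 ∧ IntermediateField.adjoin F ({α} : Set K) ≠ ⊤} ⊆ s := by
    rintro α ⟨h0, h⟩
    obtain ⟨d, hd, hα⟩ := exists_pow_eq_one_of_adjoin_ne_top h0 h
    have hd1 : d ≠ 0 := by have := (Finset.mem_Icc.mp hd).1; omega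
    have : 1 < Nat.card F ^ d := Nat.one_lt_pow hd1 Finite.one_lt_card
    exact Finset.mem_coe.mpr (Finset.mem_biUnion.mpr
      ⟨d, hd, (Polynomial.mem_nthRootsFinset (by omega) _).mpr hα⟩)
  calc Nat.card {α : K // α ≠ 0 ∧ IntermediateField.adjoin F ({α} : Set K) ≠ ⊤}
      ≤ (s : Set K).ncard := Set.ncard_le_ncard hsub s.finite_toSet
    _ = s.card := Set.ncard_coe_finset s
    _ ≤ _ := Finset.card_biUnion_le.trans (Finset.sum_le_sum fun d _ =>
      (Multiset.toFinset_card_le _).trans (Polynomial.card_nthRoots _ _))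

/-- A geometric sum with every term lowered by one. -/
theorem sub_one_mul_sum_pow_sub_one_le {q : ℕ} (hq : 1 ≤ q) (m : ℕ) :
    (q - 1) * ∑ d ∈ Finset.Icc 1 m, (q ^ d - 1) + q ≤ q ^ (m + 1) := by
  induction m with
  | zero => simp
  | succ m ih =>
    rw [Finset.sum_Icc_succ_top (by omega)]
    obtain ⟨c, rfl⟩ := Nat.exists_eq_add_of_le' hq
    have h : (c + 1) ^ (m + 1) - 1 ≤ (c + 1) ^ (m + 1) := Nat.sub_le _ _
    have h2 := Nat.mul_le_mul_left c h
    simp only [Nat.add_sub_cancel] at ih ⊢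
    rw [pow_succ _ (m + 1)]
    linarith

/-- If `F ⊆ K` are finite fields with `|F| = q`, `[K : F] = r + 1`, `r ≥ 2`, and
`q^(r-1) ≥ 16`, then more than half of the `(q^(r+1) - 1)/(q - 1)` norm-one elements
of `K` generate `K` over `F`. -/
theorem card_norm_one_generators_gt
    (F K : Type*) [Field F] [Field K] [Algebra F K] [Fintype F] [Fintype K]
    (q r : ℕ) (hq : Fintype.card F = q) (hr : Module.finrank F K = r + 1) (h2 : 2 ≤ r)
    (hbig : 16 ≤ q ^ (r - 1)) :
    (1 / 2 : ℚ) * (((q : ℚ) ^ (r + 1) - 1) / ((q : ℚ) - 1)) <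
      Nat.card {α : K // Algebra.norm F α = 1 ∧
        IntermediateField.adjoin F ({α} : Set K) = ⊤} := by
  rw [← Nat.card_eq_fintype_card] at hq
  have hq1 : 1 < q := hq ▸ Finite.one_lt_card
  have htotal := card_norm_eq_one_mul F K
  have hbad := card_adjoin_ne_top_le F K
  have hgeom := sub_one_mul_sum_pow_sub_one_le hq1.le ((r + 1) / 2)
  rw [Module.natCard_eq_pow_finrank (K := F) (V := K), hr, hq] at htotal
  rw [hr, hq] at hbad
  have hsplit : Nat.card {α : K // Algebra.norm F α = 1} ≤
      Nat.card {α : K // Algebra.norm F α = 1 ∧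
        IntermediateField.adjoin F ({α} : Set K) = ⊤} +
      Nat.card {α : K // α ≠ 0 ∧ IntermediateField.adjoin F ({α} : Set K) ≠ ⊤} := by
    refine (Set.ncard_le_ncard (s := {α : K | Algebra.norm F α = 1})
      (t := {α | Algebra.norm F α = 1 ∧ IntermediateField.adjoin F ({α} : Set K) = ⊤} ∪
        {α | α ≠ 0 ∧ IntermediateField.adjoin F ({α} : Set K) ≠ ⊤}) ?_ (Set.toFinite _)).trans
      (Set.ncard_union_le _ _)
    intro α hα
    by_cases h : IntermediateField.adjoin F ({α} : Set K) = ⊤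
    · exact Or.inl ⟨hα, h⟩
    · refine Or.inr ⟨?_, h⟩
      rintro rfl
      exact zero_ne_one ((Algebra.norm_zero (R := F) (S := K)).symm.trans hα)
  have hpow : 2 * q ^ ((r + 1) / 2 + 1) ≤ q ^ (r + 1) :=
    calc 2 * q ^ ((r + 1) / 2 + 1) ≤ q * q ^ ((r + 1) / 2 + 1) := Nat.mul_le_mul_right _ hq1
      _ = q ^ ((r + 1) / 2 + 2) := by ring
      _ ≤ q ^ (r + 1) := Nat.pow_le_pow_right hq1.le (by omega)
  generalize Nat.card {α : K // Algebra.norm F α = 1 ∧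
    IntermediateField.adjoin F ({α} : Set K) = ⊤} = G at *
  obtain ⟨c, rfl⟩ := Nat.exists_eq_add_of_le' hq1.le
  have hc : 0 < c := by omega
  simp only [Nat.add_sub_cancel] at htotal hgeom
  have hone : 1 ≤ (c + 1) ^ (r + 1) := Nat.one_le_pow _ _ (by omega)
  have hmul := Nat.mul_le_mul_right c (hsplit.trans (Nat.add_le_add_left hbad G))
  have hmain : (c + 1) ^ (r + 1) < 2 * (G * c) + 1 := by
    rw [htotal, add_mul, mul_comm (Finset.sum _ _)] at hmul
    omega
  have hcq : (0 : ℚ) < c := by exact_mod_cast hc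
  have hmainq : ((c : ℚ) + 1) ^ (r + 1) < 2 * (G * c) + 1 := by exact_mod_cast hmain
  push_cast
  rw [add_sub_cancel_right, ← mul_div_assoc, div_lt_iff₀ hcq]
  linarith
end

section
/- For every integer f ≥ 1, the numbers τ1 = 2^{4f+2} + 2^{3f+2} + 2^{2f+1} + 2^{f+1} + 1 and τ2 = 2^{4f+2} − 2^{3f+2} + 2^{2f+1} − 2^{f+1} + 1 are relatively prime, i.e., gcd(τ1, τ2) = 1. -/
/-- Lemma 4.3(iii) of Garion-Larsen-Lubotzky: for `f ≥ 1`, the torus orders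
`τ₁ = 2^(4f+2) + 2^(3f+2) + 2^(2f+1) + 2^(f+1) + 1` and
`τ₂ = 2^(4f+2) - 2^(3f+2) + 2^(2f+1) - 2^(f+1) + 1` of `²F₄(2^(2f+1))` are
relatively prime. -/
theorem tau_one_tau_two_coprime (f : ℕ) (hf : 1 ≤ f) :
    Int.gcd ((2 : ℤ) ^ (4 * f + 2) + 2 ^ (3 * f + 2) + 2 ^ (2 * f + 1) + 2 ^ (f + 1) + 1)
      ((2 : ℤ) ^ (4 * f + 2) - 2 ^ (3 * f + 2) + 2 ^ (2 * f + 1) - 2 ^ (f + 1) + 1) = 1 := by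
  rw [← Int.isCoprime_iff_gcd_eq_one]
  refine ⟨1 - (2 * (2 ^ f) ^ 4 + 2 * (2 ^ f) ^ 3 + (2 ^ f) ^ 2 + 2 ^ f) * (1 - 2 ^ f),
    -((2 * (2 ^ f) ^ 4 + 2 * (2 ^ f) ^ 3 + (2 ^ f) ^ 2 + 2 ^ f) * (1 + 2 ^ f)), ?_⟩
  simp only [pow_add, pow_mul', pow_one]
  ring
end

section
/- Let q ≥ 2 be an integer and let r be a positive integer with r ≡ 2 (mod 4). Then gcd(q^r − 1, (q^{r−2} + 1)(q² + 1)) divides gcd(2, q − 1)². -/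
theorem dvd_gcd_two_sub_one {q d : ℤ} {n : ℕ} (hn : n ≠ 0) (hd : d ∣ q ^ n - 1) (h2 : d ∣ 2) :
    d ∣ Int.gcd 2 (q - 1) := by
  refine Int.dvd_coe_gcd h2 ?_
  rcases Int.even_or_odd q with h | h
  · have hq : d ∣ q ^ n := h2.trans (h.two_dvd.trans (dvd_pow_self q hn))
    have h1 : d ∣ 1 := by simpa using dvd_sub hq hd
    exact h1.trans (one_dvd _)
  · exact h2.trans (h.sub_odd odd_one).two_dvd

theorem dvd_two_of_dvd_sq_add_one {q d : ℤ} {k : ℕ} (hd : d ∣ q ^ (4 * k + 2) - 1)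
    (h : d ∣ q ^ 2 + 1) : d ∣ 2 := by
  have hodd : q ^ 2 + 1 ∣ q ^ (4 * k + 2) + 1 := by
    have := Odd.add_dvd_pow_add_pow (q ^ 2) 1 (odd_two_mul_add_one k)
    rwa [one_pow, ← pow_mul, show 2 * (2 * k + 1) = 4 * k + 2 by ring] at this
  have := dvd_sub (h.trans hodd) hd
  rwa [show q ^ (4 * k + 2) + 1 - (q ^ (4 * k + 2) - 1) = 2 by ring] at this

theorem dvd_sq_add_one_of_dvd_pow_add_one {q d : ℤ} {n : ℕ} (hd : d ∣ q ^ (n + 2) - 1)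
    (h : d ∣ q ^ n + 1) : d ∣ q ^ 2 + 1 := by
  have := dvd_sub (h.mul_left (q ^ 2)) hd
  rwa [show q ^ 2 * (q ^ n + 1) - (q ^ (n + 2) - 1) = q ^ 2 + 1 by ring] at this

/-- For `q ≥ 2` and `r ≡ 2 (mod 4)` positive, the gcd of the torus orders
`q^r - 1` and `(q^(r-2) + 1)(q² + 1)` of `Spin⁺_{2r}(F_q)` divides `gcd(2, q-1)²`. -/
theorem torus_gcd_Dr_two_mod_four (q : ℤ) (hq : 2 ≤ q) (r : ℕ) (hr : 0 < r)
    (hmod : r % 4 = 2) :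
    Int.gcd (q ^ r - 1) ((q ^ (r - 2) + 1) * (q ^ 2 + 1)) ∣ Int.gcd 2 (q - 1) ^ 2 := by
  obtain ⟨k, rfl⟩ : ∃ k, r = 4 * k + 2 := ⟨r / 4, by omega⟩
  rw [Nat.add_sub_cancel, sq (Int.gcd 2 (q - 1))]
  have key (b : ℤ) (hb : ∀ d, d ∣ q ^ (4 * k + 2) - 1 → d ∣ b → d ∣ q ^ 2 + 1) :
      Int.gcd (q ^ (4 * k + 2) - 1) b ∣ Int.gcd 2 (q - 1) := by
    have hd := Int.gcd_dvd_left (q ^ (4 * k + 2) - 1) b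
    have h2 := dvd_two_of_dvd_sq_add_one hd (hb _ hd (Int.gcd_dvd_right _ _))
    exact_mod_cast dvd_gcd_two_sub_one hr.ne' hd h2
  exact (Int.gcd_mul_right_dvd_mul_gcd _ _ _).trans (mul_dvd_mul
    (key _ fun _ hd h => dvd_sq_add_one_of_dvd_pow_add_one hd h) (key _ fun _ _ h => h))
end

section
/- Let q ≥ 2 be an integer and let r be an odd positive integer. Then gcd(q^r − 1, (q^{r−1} + 1)(q + 1)) divides gcd(2, q + 1)². -/
theorem Int.gcd_pow_sub_one_add_one_dvd (q : ℤ) {r : ℕ} (hodd : Odd r) :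
    Int.gcd (q ^ r - 1) (q + 1) ∣ Int.gcd 2 (q + 1) := by
  have hdvd : q + 1 ∣ q ^ r + 1 := by
    simpa using hodd.add_dvd_pow_add_pow q 1
  refine Int.dvd_gcd ?_ (Int.gcd_dvd_right ..)
  have h := dvd_sub ((Int.gcd_dvd_right (q ^ r - 1) (q + 1)).trans hdvd)
    (Int.gcd_dvd_left (q ^ r - 1) (q + 1))
  rwa [show q ^ r + 1 - (q ^ r - 1) = 2 by ring] at h

theorem Int.gcd_pow_sub_one_pow_pred_add_one_dvd (q : ℤ) {r : ℕ} (hr : 0 < r) :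
    Int.gcd (q ^ r - 1) (q ^ (r - 1) + 1) ∣ Int.gcd (q ^ r - 1) (q + 1) := by
  refine Int.dvd_gcd (Int.gcd_dvd_left ..) ?_
  have h := dvd_sub ((Int.gcd_dvd_right (q ^ r - 1) (q ^ (r - 1) + 1)).mul_left q)
    (Int.gcd_dvd_left (q ^ r - 1) (q ^ (r - 1) + 1))
  rwa [mul_add, mul_pow_sub_one hr.ne', show q ^ r + q * 1 - (q ^ r - 1) = q + 1 by ring] at h

/-- For `q ≥ 2` and `r` odd positive, the gcd of the torus orders
`q^r - 1` and `(q^(r-1) + 1)(q + 1)` of `Spin⁺_{2r}(F_q)` divides `gcd(2, q+1)²`. -/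
theorem torus_gcd_Dr_odd (q : ℤ) (hq : 2 ≤ q) (r : ℕ) (hr : 0 < r) (hodd : Odd r) :
    Int.gcd (q ^ r - 1) ((q ^ (r - 1) + 1) * (q + 1)) ∣ Int.gcd 2 (q + 1) ^ 2 := by
  have h := Int.gcd_pow_sub_one_add_one_dvd q hodd
  rw [sq]
  exact (Int.gcd_mul_right_dvd_mul_gcd ..).trans
    (mul_dvd_mul ((Int.gcd_pow_sub_one_pow_pred_add_one_dvd q hr).trans h) h)
end

section
/- Let q ≥ 2 be an integer and let r be an even positive integer. Then gcd(q^r + 1, (q^{r−1} − 1)(q + 1)) divides gcd(2, q + 1)². -/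
theorem Int.gcd_pow_add_one_add_one_dvd {r : ℕ} (q : ℤ) (heven : Even r) :
    Int.gcd (q ^ r + 1) (q + 1) ∣ Int.gcd 2 (q + 1) := by
  refine Int.dvd_gcd ?_ (Int.gcd_dvd_right ..)
  have h : q + 1 ∣ q ^ r - 1 := by
    simpa [heven.neg_one_pow] using sub_dvd_pow_sub_pow q (-1) r
  have h2 := dvd_sub (Int.gcd_dvd_left (q ^ r + 1) (q + 1))
    ((Int.gcd_dvd_right (q ^ r + 1) (q + 1)).trans h)
  ring_nf at h2 ⊢
  exact h2

theorem Int.gcd_pow_succ_add_one_pow_sub_one_dvd (q : ℤ) (k : ℕ) :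
    Int.gcd (q ^ (k + 1) + 1) (q ^ k - 1) ∣ Int.gcd (q ^ (k + 1) + 1) (q + 1) := by
  refine Int.dvd_gcd (Int.gcd_dvd_left ..) ?_
  have h := dvd_sub (Int.gcd_dvd_left (q ^ (k + 1) + 1) (q ^ k - 1))
    ((Int.gcd_dvd_right (q ^ (k + 1) + 1) (q ^ k - 1)).mul_left q)
  rwa [show q ^ (k + 1) + 1 - q * (q ^ k - 1) = q + 1 by ring] at h

/-- For `q ≥ 2` and `r` even positive, the gcd of the torus orders
`q^r + 1` and `(q^(r-1) - 1)(q + 1)` of `Spin⁻_{2r}(F_q)` divides `gcd(2, q+1)²`. -/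
theorem torus_gcd_2Dr_even (q : ℤ) (hq : 2 ≤ q) (r : ℕ) (hr : 0 < r) (heven : Even r) :
    Int.gcd (q ^ r + 1) ((q ^ (r - 1) - 1) * (q + 1)) ∣ Int.gcd 2 (q + 1) ^ 2 := by
  obtain ⟨k, rfl⟩ := Nat.exists_eq_succ_of_ne_zero hr.ne'
  have h := Int.gcd_pow_add_one_add_one_dvd q heven
  rw [sq, Int.gcd_eq_natAbs, Int.natAbs_mul]
  exact (Nat.gcd_mul_right_dvd_mul_gcd _ _ _).trans
    (mul_dvd_mul ((Int.gcd_pow_succ_add_one_pow_sub_one_dvd q k).trans h) h)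
end

section
/- For every integer q ≥ 2, gcd((q − 1)(q⁶ + q³ + 1), (q + 1)(q⁶ − q⁵ + q⁴ − q³ + q² − q + 1)) divides gcd(2, q − 1). Equivalently, gcd(Φ₁(q)Φ₉(q), Φ₂(q)Φ₁₄(q)) divides gcd(2, q − 1), where Φ_n denotes the n-th cyclotomic polynomial. -/
/-- A common divisor of `q ^ 7 + 1` and `q ^ 9 - 1` divides `2`, since `q ^ 63` is congruent
to both `-1` and `1` modulo it. -/
theorem dvd_two_of_dvd_pow_seven_add_one_of_dvd_pow_nine_sub_one {d q : ℤ}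
    (h₇ : d ∣ q ^ 7 + 1) (h₉ : d ∣ q ^ 9 - 1) : d ∣ 2 := by
  have h₁ : d ∣ (q ^ 7) ^ 9 + 1 ^ 9 :=
    h₇.trans (Odd.add_dvd_pow_add_pow (q ^ 7) 1 (by decide))
  have h₂ : d ∣ (q ^ 9) ^ 7 - 1 ^ 7 := h₉.trans (sub_dvd_pow_sub_pow (q ^ 9) 1 7)
  have h := dvd_sub h₁ h₂
  ring_nf at h
  exact h

/-- For every integer `q ≥ 2`, `gcd(Φ₁(q)Φ₉(q), Φ₂(q)Φ₁₄(q))` divides `gcd(2, q-1)`,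
written out explicitly:
`gcd((q-1)(q⁶+q³+1), (q+1)(q⁶-q⁵+q⁴-q³+q²-q+1)) ∣ gcd(2, q-1)`. -/
theorem torus_gcd_E7 (q : ℤ) (hq : 2 ≤ q) :
    Int.gcd ((q - 1) * (q ^ 6 + q ^ 3 + 1))
      ((q + 1) * (q ^ 6 - q ^ 5 + q ^ 4 - q ^ 3 + q ^ 2 - q + 1)) ∣
      Int.gcd 2 (q - 1) := by
  set a := (q - 1) * (q ^ 6 + q ^ 3 + 1) with ha
  set b := (q + 1) * (q ^ 6 - q ^ 5 + q ^ 4 - q ^ 3 + q ^ 2 - q + 1) with hb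
  have hb' : b = q ^ 7 + 1 := by rw [hb]; ring
  have h₇ : (Int.gcd a b : ℤ) ∣ q ^ 7 + 1 := hb' ▸ Int.gcd_dvd_right a b
  have h₉ : (Int.gcd a b : ℤ) ∣ q ^ 9 - 1 :=
    (Int.gcd_dvd_left a b).trans ⟨q ^ 2 + q + 1, by rw [ha]; ring⟩
  have h₂ := dvd_two_of_dvd_pow_seven_add_one_of_dvd_pow_nine_sub_one h₇ h₉
  have hpar : (2 : ℤ) ∣ q ^ 7 + 1 - (q - 1) := by
    rw [← even_iff_two_dvd]
    simp [parity_simps]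
  exact Int.dvd_gcd h₂ ((dvd_sub_right h₇).mp (h₂.trans hpar))
end
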